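/- There exists a finite constant C such that for all integers 0 ≤ k < h, if the chain Z starts at k then E[τ_h] < (h − k) + C·h^{1/2}. -/

import Mathlib

open MeasureTheory ProbabilityTheory
open scoped ENNReal

/-- ρ(i,j) := 2^{−i−j−1}·(i+j)!/(i!·j!). -/
noncomputable def rho (i j : ℕ) : ℝ :=
  (2 : ℝ) ^ (-(i : ℝ) - (j : ℝ) - 1) * (Nat.factorial (i + j)) /
    ((Nat.factorial i) * (Nat.factorial j))

/-- `Z` is a Markov chain with transition probabilities `trans` started at `k`:
`P(Z_0 = k) = 1` and
`P(Z_0 = k_0, …, Z_n = k_n) = P(Z_0 = k_0) · ∏_{0 ≤ i < n} trans(k_i, k_{i+1})`. -/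
def IsMarkovChainFrom {Ω : Type*} [MeasurableSpace Ω] (P : Measure Ω)
    (Z : ℕ → Ω → ℕ) (trans : ℕ → ℕ → ℝ) (k : ℕ) : Prop :=
  (∀ t, Measurable (Z t)) ∧
    ∀ (n : ℕ) (ks : ℕ → ℕ),
      P {ω | ∀ i ≤ n, Z i ω = ks i} =
        ENNReal.ofReal ((if ks 0 = k then 1 else 0) *
          ∏ i ∈ Finset.range n, trans (ks i) (ks (i + 1)))

/-- `τ_h := inf{t ≥ 0 : Z_t ≥ h}` (with value `∞` if there is no such `t`). -/
noncomputable def tau {Ω : Type*} (Z : ℕ → Ω → ℕ) (h : ℕ) (ω : Ω) : ℕ∞ :=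
  sInf ((↑) '' {t : ℕ | h ≤ Z t ω} : Set ℕ∞)

lemma rho_eq (i j : ℕ) :
    rho i j = ((i + j).factorial : ℝ) / (i.factorial * j.factorial) * (1 / 2) ^ (i + j + 1) := by
  have h : (-(i : ℝ) - (j : ℝ) - 1) = -((i + j + 1 : ℕ) : ℝ) := by push_cast; ring
  rw [rho, h, Real.rpow_neg (by norm_num), Real.rpow_natCast, one_div, inv_pow]
  ring

lemma rho_pos (i j : ℕ) : 0 < rho i j := by
  rw [rho_eq]; positivity

lemma rho_comm (i j : ℕ) : rho i j = rho j i := by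
  rw [rho_eq, rho_eq, add_comm j i, mul_comm (j.factorial : ℝ)]

lemma rho_succ_left (i j : ℕ) : 2 * (i + 1) * rho (i + 1) j = (i + 1 + j) * rho i j := by
  have h : i + 1 + j = i + j + 1 := by ring
  rw [rho_eq, rho_eq, h, Nat.factorial_succ (i + j), Nat.factorial_succ i, pow_succ _ (i + j + 1)]
  push_cast
  field_simp
  ring

lemma succ_mul_rho_succ_right (i j : ℕ) : (j + 1 : ℝ) * rho i (j + 1) = (i + 1) * rho (i + 1) j := by
  have h : i + 1 + j = i + (j + 1) := by ring
  rw [rho_eq, rho_eq, h, Nat.factorial_succ j, Nat.factorial_succ i]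
  push_cast
  field_simp

/-- The first-step decomposition (Pascal's rule) for the negative binomial weights. -/
lemma rho_succ_succ (i j : ℕ) : rho (i + 1) (j + 1) = (rho i (j + 1) + rho (i + 1) j) / 2 := by
  have h1 := rho_succ_left i (j + 1)
  have h2 := succ_mul_rho_succ_right i j
  push_cast at h1
  have hi : (i + 1 : ℝ) ≠ 0 := by positivity
  apply mul_left_cancel₀ hi
  linarith

lemma rho_zero_right_succ (i : ℕ) : rho (i + 1) 0 = rho i 0 / 2 := by
  have h1 := rho_succ_left i 0
  have hi : (i + 1 : ℝ) ≠ 0 := by positivity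
  apply mul_left_cancel₀ hi
  push_cast at h1
  linarith

lemma hasSum_rho (i : ℕ) : HasSum (rho i) 1 := by
  have h := (hasSum_choose_mul_geometric_of_norm_lt_one (𝕜 := ℝ) i (r := 1 / 2)
    (by norm_num)).mul_right ((1 / 2 : ℝ) ^ (i + 1))
  have hval : 1 / (1 - 1 / 2 : ℝ) ^ (i + 1) * (1 / 2) ^ (i + 1) = 1 := by
    rw [show (1 : ℝ) - 1 / 2 = 1 / 2 by norm_num]
    field_simp
  rw [hval] at h
  refine h.congr_fun fun j => ?_
  rw [rho_eq, Nat.cast_choose ℝ (Nat.le_add_left i j), Nat.add_sub_cancel, add_comm i j,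
    add_assoc, pow_add _ j]
  ring

lemma hasSum_mul_rho (i : ℕ) : HasSum (fun j : ℕ => (j : ℝ) * rho i j) (i + 1) := by
  rw [← hasSum_nat_add_iff' 1]
  simpa [succ_mul_rho_succ_right] using (hasSum_rho (i + 1)).mul_left (i + 1 : ℝ)

lemma hasSum_mul_sub_one_mul_rho (i : ℕ) :
    HasSum (fun j : ℕ => (j : ℝ) * (j - 1) * rho i j) ((i + 1) * (i + 2)) := by
  rw [← hasSum_nat_add_iff' 1]
  have h := (hasSum_mul_rho (i + 1)).mul_left (i + 1 : ℝ)
  have hval : (i + 1 : ℝ) * ((i + 1 : ℕ) + 1) =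
      (i + 1) * (i + 2) - ∑ j ∈ Finset.range 1, (j : ℝ) * (j - 1) * rho i j := by
    rw [Finset.sum_range_one]
    push_cast
    ring
  rw [hval] at h
  refine h.congr_fun fun j => ?_
  have := succ_mul_rho_succ_right i j
  push_cast
  linear_combination (j : ℝ) * this

/-- The negative binomial law `rho i` has variance `2 * (i + 1)`. -/
lemma hasSum_sq_sub_mul_rho (i : ℕ) :
    HasSum (fun j : ℕ => ((j : ℝ) - (i + 1)) ^ 2 * rho i j) (2 * (i + 1) : ℝ) := by
  have h := ((hasSum_mul_sub_one_mul_rho i).add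
    ((hasSum_mul_rho i).mul_left (1 - 2 * (i + 1 : ℝ)))).add
    ((hasSum_rho i).mul_left ((i + 1 : ℝ) ^ 2))
  have hval : (i + 1 : ℝ) * (i + 2) + (1 - 2 * (i + 1 : ℝ)) * (i + 1) + (i + 1 : ℝ) ^ 2 * 1 =
      2 * (i + 1) := by ring
  rw [hval] at h
  refine h.congr_fun fun j => ?_
  ring

lemma sum_range_rho_succ (n m : ℕ) :
    ∑ j ∈ Finset.range (m + 1), rho (n + 1) j =
      ∑ j ∈ Finset.range (m + 1), rho n j - rho (n + 1) m := by
  induction m with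
  | zero =>
    simp only [zero_add, Finset.sum_range_one, rho_zero_right_succ]
    ring
  | succ m ih =>
    rw [Finset.sum_range_succ, ih, Finset.sum_range_succ _ (m + 1), rho_succ_succ]
    ring

/-- By symmetry, the median of `rho n` splits its mass evenly. -/
lemma sum_range_rho_self (n : ℕ) : ∑ j ∈ Finset.range (n + 1), rho n j = 1 / 2 := by
  induction n with
  | zero => simp [rho_eq]
  | succ n ih =>
    rw [sum_range_rho_succ, Finset.sum_range_succ, ih, rho_succ_succ, rho_comm (n + 1) n]
    ring

lemma summable_sub_mul_rho (i : ℕ) (c : ℝ) : Summable fun j : ℕ => ((j : ℝ) - c) * rho i j := by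
  refine ((hasSum_mul_rho i).summable.sub ((hasSum_rho i).summable.mul_left c)).congr fun j => ?_
  ring

lemma tsum_tail_rho_self (n : ℕ) : ∑' j : ℕ, rho n (j + (n + 1)) = 1 / 2 := by
  have h := (hasSum_rho n).summable.sum_add_tsum_nat_add (n + 1)
  rw [sum_range_rho_self, (hasSum_rho n).tsum_eq] at h
  linarith

/-- Started just below `h`, the expected overshoot of `h` on the event of a crossing is at most
`3 * √h` times the probability of that event. -/
lemma tsum_overshoot_self_nonpos {n h : ℕ} (hn : n + 1 = h) :
    ∑' j : ℕ, (((j + h : ℕ) : ℝ) - (h + 3 * √h)) * rho n (j + h) ≤ 0 := by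
  have hnr : (n + 1 : ℝ) = h := by exact_mod_cast hn
  have hs0 : 0 < √(h : ℝ) := Real.sqrt_pos.2 (by rw [← hnr]; positivity)
  have hss : √(h : ℝ) ^ 2 = h := Real.sq_sqrt (by positivity)
  generalize √(h : ℝ) = s at hs0 hss ⊢
  have hv := hasSum_sq_sub_mul_rho n
  have htail := tsum_tail_rho_self n
  rw [hn] at htail
  rw [hnr] at hv
  have hvs : Summable fun j : ℕ => (((j + h : ℕ) : ℝ) - h) ^ 2 * rho n (j + h) :=
    (summable_nat_add_iff h).2 hv.summable
  have hrs : Summable fun j : ℕ => rho n (j + h) :=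
    (summable_nat_add_iff h).2 (hasSum_rho n).summable
  have hvt : ∑' j : ℕ, (((j + h : ℕ) : ℝ) - h) ^ 2 * rho n (j + h) ≤ 2 * h := by
    have hsplit := hv.summable.sum_add_tsum_nat_add h
    rw [hv.tsum_eq] at hsplit
    have : 0 ≤ ∑ j ∈ Finset.range h, ((j : ℝ) - h) ^ 2 * rho n j :=
      Finset.sum_nonneg fun j _ => mul_nonneg (sq_nonneg _) (rho_pos n j).le
    linarith
  have hle (j : ℕ) : (((j + h : ℕ) : ℝ) - (h + 3 * s)) * rho n (j + h) ≤
      1 / (2 * s) * ((((j + h : ℕ) : ℝ) - h) ^ 2 * rho n (j + h)) +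
        (s / 2 - 3 * s) * rho n (j + h) := by
    rw [← mul_assoc, ← add_mul]
    refine mul_le_mul_of_nonneg_right ?_ (rho_pos _ _).le
    generalize ((j + h : ℕ) : ℝ) = x
    have heq : 1 / (2 * s) * (x - h) ^ 2 + (s / 2 - 3 * s) - (x - (h + 3 * s)) =
        (x - h - s) ^ 2 / (2 * s) := by
      field_simp
      ring
    have : 0 ≤ (x - h - s) ^ 2 / (2 * s) := by positivity
    linarith
  have hsum := Summable.tsum_le_tsum hle ((summable_nat_add_iff h).2 (summable_sub_mul_rho n _))
    ((hvs.mul_left _).add (hrs.mul_left _))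
  rw [(hvs.mul_left _).tsum_add (hrs.mul_left _), tsum_mul_left, tsum_mul_left, htail] at hsum
  have hbound := mul_le_mul_of_nonneg_left hvt (by positivity : 0 ≤ 1 / (2 * s))
  have : 1 / (2 * s) * (2 * h) = s := by
    rw [← hss]
    field_simp
  linarith

/-- Monotone likelihood ratio: lowering the starting point does not increase the mean of the
law conditioned on exceeding a level. -/
lemma tsum_tail_nonpos_of_succ (i h : ℕ) {c : ℝ} (hc : 0 ≤ c)
    (hi : ∑' j : ℕ, (((j + h : ℕ) : ℝ) - c) * rho (i + 1) (j + h) ≤ 0) :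
    ∑' j : ℕ, (((j + h : ℕ) : ℝ) - c) * rho i (j + h) ≤ 0 := by
  have hs (i : ℕ) : Summable fun j : ℕ => (((j + h : ℕ) : ℝ) - c) * rho i (j + h) :=
    (summable_nat_add_iff h).2 (summable_sub_mul_rho i c)
  calc _ ≤ ∑' j : ℕ, (2 * (i + 1) / (i + 1 + c)) *
        ((((j + h : ℕ) : ℝ) - c) * rho (i + 1) (j + h)) := by
        refine (hs i).tsum_le_tsum (fun j => ?_) ((hs (i + 1)).mul_left _)
        generalize j + h = m
        have hr : rho i m = 2 * (i + 1) * rho (i + 1) m / (i + 1 + m) := by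
          rw [rho_succ_left]; field_simp
        rw [hr, ← sub_nonneg]
        have : 2 * (i + 1) / (i + 1 + c) * (((m : ℝ) - c) * rho (i + 1) m) -
            ((m : ℝ) - c) * (2 * (i + 1) * rho (i + 1) m / (i + 1 + m)) =
            2 * (i + 1) * rho (i + 1) m * (m - c) ^ 2 / ((i + 1 + c) * (i + 1 + m)) := by
          field_simp
          ring
        rw [this]
        have := (rho_pos (i + 1) m).le
        positivity
    _ ≤ 0 := by
        rw [tsum_mul_left]
        exact mul_nonpos_of_nonneg_of_nonpos (by positivity) hi

lemma tsum_overshoot_nonpos {i h : ℕ} (hi : i < h) :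
    ∑' j : ℕ, (((j + h : ℕ) : ℝ) - (h + 3 * √h)) * rho i (j + h) ≤ 0 := by
  refine Nat.decreasingInduction
    (motive := fun i _ => ∑' j : ℕ, (((j + h : ℕ) : ℝ) - (h + 3 * √h)) * rho i (j + h) ≤ 0)
    (fun i _ hi => tsum_tail_nonpos_of_succ i h (by positivity) hi)
    (tsum_overshoot_self_nonpos (Nat.sub_add_cancel (Nat.zero_lt_of_lt hi)))
    (Nat.le_sub_one_of_lt hi)

/-- The function `j ↦ h - j + 3 * √h` is a Lyapunov function with drift `-1` for the chain killed
at level `h`. -/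
lemma one_add_sum_rho_mul_le {i h : ℕ} (hi : i < h) :
    1 + ∑ j ∈ Finset.range h, rho i j * ((h : ℝ) - j + 3 * √h) ≤ (h : ℝ) - i + 3 * √h := by
  have h1 := (summable_sub_mul_rho i (h + 3 * √h)).sum_add_tsum_nat_add h
  have h2 : ∑' j : ℕ, ((j : ℝ) - (h + 3 * √h)) * rho i j = i + 1 - (h + 3 * √h) * 1 := by
    rw [← ((hasSum_mul_rho i).sub ((hasSum_rho i).mul_left (h + 3 * √h))).tsum_eq]
    exact tsum_congr fun j => by ring
  have h3 := tsum_overshoot_nonpos hi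
  have h4 : ∑ j ∈ Finset.range h, rho i j * ((h : ℝ) - j + 3 * √h) =
      -∑ j ∈ Finset.range h, ((j : ℝ) - (h + 3 * √h)) * rho i j := by
    rw [← Finset.sum_neg_distrib]
    exact Finset.sum_congr rfl fun j _ => by ring
  rw [h4]
  linarith

lemma tau_le_tsum_indicator {Ω : Type*} (Z : ℕ → Ω → ℕ) (h : ℕ) (ω : Ω) :
    ((tau Z h ω : ℕ∞) : ℝ≥0∞) ≤
      ∑' M : ℕ, {ω | ∀ t ≤ M, Z t ω < h}.indicator (fun _ => (1 : ℝ≥0∞)) ω := by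
  classical
  by_cases hex : ∃ t, h ≤ Z t ω
  · have h1 : tau Z h ω ≤ (Nat.find hex : ℕ∞) := sInf_le ⟨_, Nat.find_spec hex, rfl⟩
    calc ((tau Z h ω : ℕ∞) : ℝ≥0∞) ≤ ((Nat.find hex : ℕ∞) : ℝ≥0∞) := by gcongr
      _ = ∑ M ∈ Finset.range (Nat.find hex), (1 : ℝ≥0∞) := by simp
      _ = ∑ M ∈ Finset.range (Nat.find hex),
          {ω | ∀ t ≤ M, Z t ω < h}.indicator (fun _ => (1 : ℝ≥0∞)) ω := by
          refine Finset.sum_congr rfl fun M hM => ?_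
          rw [Set.indicator_of_mem]
          intro t ht
          exact not_le.1 (Nat.find_min hex (ht.trans_lt (Finset.mem_range.1 hM)))
      _ ≤ _ := ENNReal.sum_le_tsum _
  · push Not at hex
    have : ∀ M : ℕ, {ω | ∀ t ≤ M, Z t ω < h}.indicator (fun _ => (1 : ℝ≥0∞)) ω = 1 := fun M =>
      Set.indicator_of_mem (show ω ∈ {ω | ∀ t ≤ M, Z t ω < h} from fun t _ => hex t) _
    simp [this]

section Hitting

variable {Ω : Type*} [MeasurableSpace Ω] {P : Measure Ω} {Z : ℕ → Ω → ℕ} {k : ℕ}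

lemma IsMarkovChainFrom.measure_path_succ {p : ℕ → ℕ → ℝ} (hp : ∀ i j, 0 ≤ p i j)
    (hZ : IsMarkovChainFrom P Z p k) (n : ℕ) (ks : ℕ → ℕ) (j : ℕ) :
    P {ω | ∀ i ≤ n + 1, Z i ω = Function.update ks (n + 1) j i} =
      P {ω | ∀ i ≤ n, Z i ω = ks i} * ENNReal.ofReal (p (ks n) j) := by
  rw [hZ.2, hZ.2, ← ENNReal.ofReal_mul, Finset.prod_range_succ, ← mul_assoc]
  · congr 2
    · congr 1
      refine Finset.prod_congr rfl fun i hi => ?_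
      rw [Finset.mem_range] at hi
      rw [Function.update_of_ne (show i ≠ n + 1 by omega),
        Function.update_of_ne (show i + 1 ≠ n + 1 by omega)]
    · rw [Function.update_self, Function.update_of_ne (by omega)]
  · refine mul_nonneg (by split_ifs <;> norm_num) (Finset.prod_nonneg fun i _ => hp _ _)

/-- A nonnegative function with drift at most `-1` below level `h` bounds the expected time spent
below `h` after any prescribed initial path. -/
lemma IsMarkovChainFrom.sum_measure_le {p : ℕ → ℕ → ℝ} (hp : ∀ i j, 0 ≤ p i j)
    (hZ : IsMarkovChainFrom P Z p k) {h : ℕ} {V : ℕ → ℝ} (hV : ∀ i < h, 0 ≤ V i)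
    (hdrift : ∀ i < h, 1 + ∑ j ∈ Finset.range h, p i j * V j ≤ V i)
    (N n : ℕ) (ks : ℕ → ℕ) (hks : ks n < h) :
    ∑ M ∈ Finset.range N,
        P {ω | (∀ i ≤ n, Z i ω = ks i) ∧ ∀ t, n < t → t ≤ n + M → Z t ω < h} ≤
      P {ω | ∀ i ≤ n, Z i ω = ks i} * ENNReal.ofReal (V (ks n)) := by
  induction N generalizing n ks with
  | zero => simp
  | succ N ih =>
    set A := P {ω | ∀ i ≤ n, Z i ω = ks i} with hA
    have hstep (M : ℕ) :
        P {ω | (∀ i ≤ n, Z i ω = ks i) ∧ ∀ t, n < t → t ≤ n + (M + 1) → Z t ω < h} ≤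
        ∑ j ∈ Finset.range h, P {ω | (∀ i ≤ n + 1, Z i ω = Function.update ks (n + 1) j i) ∧
          ∀ t, n + 1 < t → t ≤ n + 1 + M → Z t ω < h} := by
      refine (measure_mono ?_).trans (measure_biUnion_finset_le _ _)
      rintro ω ⟨h1, h2⟩
      simp only [Set.mem_iUnion, Finset.mem_range, Set.mem_ofPred_eq, exists_prop]
      refine ⟨Z (n + 1) ω, h2 _ (by omega) (by omega), fun i hi => ?_,
        fun t ht ht' => h2 t (by omega) (by omega)⟩
      rcases hi.eq_or_lt with rfl | hi
      · rw [Function.update_self]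
      · rw [Function.update_of_ne hi.ne, h1 i (by omega)]
    rw [Finset.sum_range_succ']
    calc _ ≤ (∑ M ∈ Finset.range N, ∑ j ∈ Finset.range h,
            P {ω | (∀ i ≤ n + 1, Z i ω = Function.update ks (n + 1) j i) ∧
              ∀ t, n + 1 < t → t ≤ n + 1 + M → Z t ω < h}) + A :=
          add_le_add (Finset.sum_le_sum fun M _ => hstep M) (measure_mono fun ω hω => hω.1)
      _ ≤ (∑ j ∈ Finset.range h, A * ENNReal.ofReal (p (ks n) j * V j)) + A := by
          rw [Finset.sum_comm]
          gcongr with j hj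
          have hj' := Finset.mem_range.1 hj
          refine (ih (n + 1) (Function.update ks (n + 1) j)
            (by rwa [Function.update_self])).trans_eq ?_
          rw [hZ.measure_path_succ hp, Function.update_self, ENNReal.ofReal_mul (hp _ _), mul_assoc]
      _ = A * ENNReal.ofReal (1 + ∑ j ∈ Finset.range h, p (ks n) j * V j) := by
          have hnn : ∀ j ∈ Finset.range h, 0 ≤ p (ks n) j * V j := fun j hj =>
            mul_nonneg (hp _ _) (hV j (Finset.mem_range.1 hj))
          rw [ENNReal.ofReal_add zero_le_one (Finset.sum_nonneg hnn),
            ENNReal.ofReal_sum_of_nonneg hnn, ENNReal.ofReal_one, mul_add, mul_one,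
            ← Finset.mul_sum, add_comm]
      _ ≤ A * ENNReal.ofReal (V (ks n)) := by
          gcongr
          exact hdrift _ hks

lemma lintegral_tau_le_tsum (hZ : ∀ t, Measurable (Z t)) (h : ℕ) :
    ∫⁻ ω, ((tau Z h ω : ℕ∞) : ℝ≥0∞) ∂P ≤ ∑' M : ℕ, P {ω | ∀ t ≤ M, Z t ω < h} := by
  have hm (M : ℕ) : MeasurableSet {ω | ∀ t ≤ M, Z t ω < h} := by
    have : {ω | ∀ t ≤ M, Z t ω < h} = ⋂ t, ⋂ _ : t ≤ M, Z t ⁻¹' Set.Iio h := by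
      ext; simp
    rw [this]
    exact .iInter fun t => .iInter fun _ => hZ t (measurableSet_Iio)
  refine (lintegral_mono (tau_le_tsum_indicator Z h)).trans_eq ?_
  rw [lintegral_tsum fun M => (measurable_const.indicator (hm M)).aemeasurable]
  exact tsum_congr fun M => by rw [lintegral_indicator_const (hm M), one_mul]

/-- Foster's criterion for the hitting time of `[h, ∞)`. -/
lemma IsMarkovChainFrom.lintegral_tau_le [IsProbabilityMeasure P] {p : ℕ → ℕ → ℝ}
    (hp : ∀ i j, 0 ≤ p i j) (hZ : IsMarkovChainFrom P Z p k) {h : ℕ} (hk : k < h) {V : ℕ → ℝ}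
    (hV : ∀ i < h, 0 ≤ V i) (hdrift : ∀ i < h, 1 + ∑ j ∈ Finset.range h, p i j * V j ≤ V i) :
    ∫⁻ ω, ((tau Z h ω : ℕ∞) : ℝ≥0∞) ∂P ≤ ENNReal.ofReal (V k) := by
  have hstart : ∀ᵐ ω ∂P, Z 0 ω = k := by
    have h0 := hZ.2 0 fun _ => k
    simp only [Nat.le_zero, forall_eq, if_true, Finset.range_zero, Finset.prod_empty, mul_one,
      ENNReal.ofReal_one] at h0
    exact (prob_compl_eq_zero_iff (hZ.1 0 (measurableSet_singleton k))).2 h0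
  refine (lintegral_tau_le_tsum hZ.1 h).trans (ENNReal.tsum_le_of_sum_range_le fun N => ?_)
  calc ∑ M ∈ Finset.range N, P {ω | ∀ t ≤ M, Z t ω < h}
      ≤ ∑ M ∈ Finset.range N,
        P {ω | (∀ i ≤ 0, Z i ω = k) ∧ ∀ t, 0 < t → t ≤ 0 + M → Z t ω < h} := by
        refine Finset.sum_le_sum fun M _ => measure_mono_ae ?_
        filter_upwards [hstart] with ω hω hlt
        refine ⟨fun i hi => ?_, fun t _ ht => hlt t (by omega)⟩
        rwa [Nat.le_zero.1 hi]
    _ ≤ P {ω | ∀ i ≤ 0, Z i ω = k} * ENNReal.ofReal (V k) :=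
        hZ.sum_measure_le hp hV hdrift N 0 (fun _ => k) hk
    _ ≤ ENNReal.ofReal (V k) := mul_le_of_le_one_left zero_le prob_le_one

end Hitting

/-- There exists a finite constant C such that for all integers 0 ≤ k < h, if
the chain Z starts at k then E[τ_h] < (h − k) + C·h^{1/2}. -/
theorem stmt_17 :
    ∃ C : ℝ,
      ∀ (h k : ℕ), k < h →
        ∀ (Ω : Type) (_ : MeasurableSpace Ω) (P : Measure Ω) (Z : ℕ → Ω → ℕ),
          IsProbabilityMeasure P → IsMarkovChainFrom P Z rho k →
          ∫⁻ ω, ((tau Z h ω : ℕ∞) : ℝ≥0∞) ∂P <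
            ENNReal.ofReal (((h : ℝ) - (k : ℝ)) + C * (h : ℝ) ^ ((1 : ℝ) / 2)) := by
  refine ⟨4, fun h k hk Ω _ P Z _ hZ => ?_⟩
  have hk' : (k : ℝ) < h := by exact_mod_cast hk
  have hs : 0 < √(h : ℝ) := Real.sqrt_pos.2 (by exact_mod_cast Nat.zero_lt_of_lt hk)
  refine (hZ.lintegral_tau_le (fun i j => (rho_pos i j).le) hk
    (V := fun i => (h : ℝ) - i + 3 * √h) (fun i hi => ?_)
    fun i hi => one_add_sum_rho_mul_le hi).trans_lt ?_
  · have : (i : ℝ) < h := by exact_mod_cast hi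
    linarith
  · rw [← Real.sqrt_eq_rpow]
    exact (ENNReal.ofReal_lt_ofReal_iff (by linarith)).2 (by linarith)
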